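/- Let k, m ≥ 1, T > 0, let a_1, …, a_{k+m} and b_1, …, b_{k+m} be nonzero real numbers, and let C = (c_{ij}) be a real k × m matrix which is a contraction, i.e. Σ_{i=1}^k (Σ_{j=1}^m c_{ij} x_j)^2 ≤ Σ_{j=1}^m x_j^2 for every x ∈ ℝ^m. Let u_1, …, u_k, v_1, …, v_m : ℝ × ℝ → ℝ be smooth, with ∂_t u_i = ∂_x^5 u_i for all x ≤ 0 and t ∈ [0,T], ∂_t v_j = ∂_x^5 v_j for all x ≥ 0 and t ∈ [0,T], each u_i having left-decay of order 5 on [0,T] and each v_j having right-decay of order 5 on [0,T], and suppose the Kawahara vertex conditions with data (a, b, C) hold on [0,T]. Then the total energy t ↦ Σ_{i=1}^k ∫_{-∞}^0 u_i(x,t)^2 dx + Σ_{j=1}^m ∫_0^{∞} v_j(x,t)^2 dx is nonincreasing on [0,T]. -/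

import Mathlib

open MeasureTheory Set Matrix

/-- `k`-th partial derivative in the first (space) variable of `w : ℝ × ℝ → ℝ`. -/
noncomputable def pdx (k : ℕ) (w : ℝ × ℝ → ℝ) (x t : ℝ) : ℝ :=
  iteratedDeriv k (fun y => w (y, t)) x

/-- Partial derivative in the second (time) variable of `w : ℝ × ℝ → ℝ`. -/
noncomputable def pdt (w : ℝ × ℝ → ℝ) (x t : ℝ) : ℝ :=
  deriv (fun s => w (x, s)) t

/-- `w` has left-decay of order 5 on `[0,T]`. -/
def LeftDecay5 (w : ℝ × ℝ → ℝ) (T : ℝ) : Prop :=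
  ∃ C > (0:ℝ), ∀ k ≤ 5, ∀ t ∈ Icc (0:ℝ) T, ∀ x ≤ (0:ℝ),
    |pdx k w x t| ≤ C * (1 + x ^ 2)⁻¹

/-- `w` has right-decay of order 5 on `[0,T]`. -/
def RightDecay5 (w : ℝ × ℝ → ℝ) (T : ℝ) : Prop :=
  ∃ C > (0:ℝ), ∀ k ≤ 5, ∀ t ∈ Icc (0:ℝ) T, ∀ x : ℝ, 0 ≤ x →
    |pdx k w x t| ≤ C * (1 + x ^ 2)⁻¹

/-- The Kawahara vertex conditions with data `(a, b, C)` on `[0,T]`,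
for the edge functions `u i` (edges `(-∞,0)`) and `v j` (edges `(0,∞)`).
The distinguished first edge is `u ⟨0, hk⟩`. -/
def KawaharaVertexConditions (k m : ℕ) (hk : 0 < k) (T : ℝ)
    (a b : Fin (k + m) → ℝ) (C : Matrix (Fin k) (Fin m) ℝ)
    (u : Fin k → ℝ × ℝ → ℝ) (v : Fin m → ℝ × ℝ → ℝ) : Prop :=
  ∀ t ∈ Icc (0:ℝ) T,
    (∀ i : Fin k, u ⟨0, hk⟩ (0, t) = a (Fin.castAdd m i) * u i (0, t)) ∧
    (∀ j : Fin m, u ⟨0, hk⟩ (0, t) = a (Fin.natAdd k j) * v j (0, t)) ∧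
    (∀ i : Fin k, pdx 1 (u ⟨0, hk⟩) 0 t = b (Fin.castAdd m i) * pdx 1 (u i) 0 t) ∧
    (∀ j : Fin m, pdx 1 (u ⟨0, hk⟩) 0 t = b (Fin.natAdd k j) * pdx 1 (v j) 0 t) ∧
    (∀ i : Fin k, pdx 2 (u i) 0 t = ∑ j : Fin m, C i j * pdx 2 (v j) 0 t) ∧
    (∑ i : Fin k, (b (Fin.castAdd m i))⁻¹ * pdx 3 (u i) 0 t
      = ∑ j : Fin m, (b (Fin.natAdd k j))⁻¹ * pdx 3 (v j) 0 t) ∧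
    (∑ i : Fin k, (a (Fin.castAdd m i))⁻¹ * pdx 4 (u i) 0 t
      = ∑ j : Fin m, (a (Fin.natAdd k j))⁻¹ * pdx 4 (v j) 0 t)

open Filter Topology

/-- The boundary flux `w ∂ₓ⁴w - ∂ₓw ∂ₓ³w + (∂ₓ²w)² / 2` of the fifth-order equation. -/
noncomputable def kawaharaFlux (w : ℝ × ℝ → ℝ) (x t : ℝ) : ℝ :=
  pdx 0 w x t * pdx 4 w x t - pdx 1 w x t * pdx 3 w x t + pdx 2 w x t ^ 2 / 2

lemma pdx_zero (w : ℝ × ℝ → ℝ) (x t : ℝ) : pdx 0 w x t = w (x, t) := by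
  simp [pdx]

lemma hasDerivAt_pdx {w : ℝ × ℝ → ℝ} (hw : ContDiff ℝ (⊤ : ℕ∞) w) (k : ℕ) (x t : ℝ) :
    HasDerivAt (fun y => pdx k w y t) (pdx (k + 1) w x t) x := by
  have hsec : ContDiff ℝ (⊤ : ℕ∞) (fun y => w (y, t)) := by fun_prop
  have hdiff : Differentiable ℝ (iteratedDeriv k (fun y => w (y, t))) :=
    hsec.differentiable_iteratedDeriv k (by exact_mod_cast WithTop.coe_lt_top k)
  have hderiv := (hdiff x).hasDerivAt
  rw [← iteratedDeriv_succ] at hderiv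
  exact hderiv

lemma continuous_pdx {w : ℝ × ℝ → ℝ} (hw : ContDiff ℝ (⊤ : ℕ∞) w) (k : ℕ) (t : ℝ) :
    Continuous fun x => pdx k w x t :=
  continuous_iff_continuousAt.2 fun x => (hasDerivAt_pdx hw k x t).continuousAt

lemma hasDerivAt_pdt {w : ℝ × ℝ → ℝ} (hw : ContDiff ℝ (⊤ : ℕ∞) w) (x t : ℝ) :
    HasDerivAt (fun s => w (x, s)) (pdt w x t) t := by
  have hsec : ContDiff ℝ (⊤ : ℕ∞) (fun s => w (x, s)) := by fun_prop
  exact (hsec.differentiable (by simp) t).hasDerivAt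

lemma hasDerivAt_kawaharaFlux {w : ℝ × ℝ → ℝ} (hw : ContDiff ℝ (⊤ : ℕ∞) w) (x t : ℝ) :
    HasDerivAt (fun y => kawaharaFlux w y t) (pdx 0 w x t * pdx 5 w x t) x := by
  have h := (((hasDerivAt_pdx hw 0 x t).mul (hasDerivAt_pdx hw 4 x t)).sub
    ((hasDerivAt_pdx hw 1 x t).mul (hasDerivAt_pdx hw 3 x t))).add
    (((hasDerivAt_pdx hw 2 x t).pow 2).div_const 2)
  refine h.congr_deriv ?_
  norm_num
  ring

lemma abs_mul_le_of_decay {p q K x : ℝ} (hp : |p| ≤ K * (1 + x ^ 2)⁻¹)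
    (hq : |q| ≤ K * (1 + x ^ 2)⁻¹) : |p * q| ≤ K ^ 2 * (1 + x ^ 2)⁻¹ := by
  have hpos : 0 < (1 + x ^ 2)⁻¹ := by positivity
  have hle : (1 + x ^ 2)⁻¹ ≤ 1 := inv_le_one_of_one_le₀ (by nlinarith [sq_nonneg x])
  calc |p * q| = |p| * |q| := abs_mul p q
    _ ≤ (K * (1 + x ^ 2)⁻¹) * (K * (1 + x ^ 2)⁻¹) :=
        mul_le_mul hp hq (abs_nonneg q) ((abs_nonneg p).trans hp)
    _ = K ^ 2 * ((1 + x ^ 2)⁻¹ * (1 + x ^ 2)⁻¹) := by ring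
    _ ≤ K ^ 2 * ((1 + x ^ 2)⁻¹ * 1) := by gcongr
    _ = K ^ 2 * (1 + x ^ 2)⁻¹ := by ring

lemma abs_kawaharaFlux_le {w : ℝ × ℝ → ℝ} {K x t : ℝ}
    (hdec : ∀ k ≤ 5, |pdx k w x t| ≤ K * (1 + x ^ 2)⁻¹) :
    |kawaharaFlux w x t| ≤ 3 * K ^ 2 * (1 + x ^ 2)⁻¹ := by
  have h04 := abs_mul_le_of_decay (hdec 0 (by norm_num)) (hdec 4 (by norm_num))
  have h13 := abs_mul_le_of_decay (hdec 1 (by norm_num)) (hdec 3 (by norm_num))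
  have h22 := abs_mul_le_of_decay (hdec 2 (by norm_num)) (hdec 2 (by norm_num))
  rw [abs_le] at h04 h13 h22 ⊢
  unfold kawaharaFlux
  constructor <;> nlinarith

lemma tendsto_const_mul_inv_one_add_sq {l : Filter ℝ} (hl : l ≤ cocompact ℝ) (K : ℝ) :
    Tendsto (fun x : ℝ => K * (1 + x ^ 2)⁻¹) l (𝓝 0) := by
  have hsq : Tendsto (fun x : ℝ => x ^ 2) (cocompact ℝ) atTop := by
    have h := (tendsto_pow_atTop (two_ne_zero)).comp (tendsto_norm_cocompact_atTop (E := ℝ))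
    refine h.congr fun x => ?_
    simp
  have h := (tendsto_inv_atTop_zero.comp (tendsto_atTop_add_const_left _ 1 hsq)).const_mul K
  rw [mul_zero] at h
  exact h.mono_left hl

section EdgeEnergy

variable {w : ℝ × ℝ → ℝ} {S : Set ℝ} {K T : ℝ}

lemma integrableOn_flux_deriv (hw : ContDiff ℝ (⊤ : ℕ∞) w) (hS : MeasurableSet S) {t : ℝ}
    (hdec : ∀ k ≤ 5, ∀ x ∈ S, |pdx k w x t| ≤ K * (1 + x ^ 2)⁻¹) :
    IntegrableOn (fun x => pdx 0 w x t * pdx 5 w x t) S := by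
  refine Integrable.mono' ((integrable_inv_one_add_sq.const_mul (K ^ 2)).integrableOn)
    ((continuous_pdx hw 0 t).mul (continuous_pdx hw 5 t)).aestronglyMeasurable ?_
  refine (ae_restrict_iff' hS).2 (ae_of_all _ fun x hx => ?_)
  exact abs_mul_le_of_decay (hdec 0 (by norm_num) x hx) (hdec 5 le_rfl x hx)

lemma aestronglyMeasurable_sq (hw : ContDiff ℝ (⊤ : ℕ∞) w) (t : ℝ) (μ : Measure ℝ) :
    AEStronglyMeasurable (fun x => w (x, t) ^ 2) μ := by
  have := hw.continuous
  exact Continuous.aestronglyMeasurable (by fun_prop)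

lemma sq_le_of_decay {x t : ℝ} (hdec : |pdx 0 w x t| ≤ K * (1 + x ^ 2)⁻¹) :
    ‖w (x, t) ^ 2‖ ≤ K ^ 2 * (1 + x ^ 2)⁻¹ := by
  have h := abs_mul_le_of_decay hdec hdec
  rwa [← sq, pdx_zero] at h

lemma continuousOn_energy (hw : ContDiff ℝ (⊤ : ℕ∞) w) (hS : MeasurableSet S)
    (hdec : ∀ k ≤ 5, ∀ t ∈ Icc (0 : ℝ) T, ∀ x ∈ S, |pdx k w x t| ≤ K * (1 + x ^ 2)⁻¹) :
    ContinuousOn (fun t => ∫ x in S, w (x, t) ^ 2) (Icc 0 T) := by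
  refine continuousOn_of_dominated (bound := fun x => K ^ 2 * (1 + x ^ 2)⁻¹)
    (fun t _ => aestronglyMeasurable_sq hw t _) (fun t ht => ?_)
    ((integrable_inv_one_add_sq.const_mul (K ^ 2)).integrableOn) (ae_of_all _ fun x => ?_)
  · exact (ae_restrict_iff' hS).2
      (ae_of_all _ fun x hx => sq_le_of_decay (hdec 0 (by norm_num) t ht x hx))
  · have := hw.continuous
    exact Continuous.continuousOn (by fun_prop)

lemma hasDerivAt_energy (hw : ContDiff ℝ (⊤ : ℕ∞) w) (hS : MeasurableSet S)
    (heq : ∀ x ∈ S, ∀ t ∈ Icc (0 : ℝ) T, pdt w x t = pdx 5 w x t)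
    (hdec : ∀ k ≤ 5, ∀ t ∈ Icc (0 : ℝ) T, ∀ x ∈ S, |pdx k w x t| ≤ K * (1 + x ^ 2)⁻¹)
    {t : ℝ} (ht : t ∈ Ioo 0 T) :
    HasDerivAt (fun t => ∫ x in S, w (x, t) ^ 2)
      (2 * ∫ x in S, pdx 0 w x t * pdx 5 w x t) t := by
  have htI := Ioo_subset_Icc_self ht
  rw [← integral_const_mul]
  refine (hasDerivAt_integral_of_dominated_loc_of_deriv_le (Ioo_mem_nhds ht.1 ht.2)
    (bound := fun x => 2 * (K ^ 2 * (1 + x ^ 2)⁻¹))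
    (F' := fun t x => 2 * (pdx 0 w x t * pdx 5 w x t))
    (Eventually.of_forall fun s => aestronglyMeasurable_sq hw s _) ?_ ?_ ?_ ?_ ?_).2
  · refine Integrable.mono' ((integrable_inv_one_add_sq.const_mul (K ^ 2)).integrableOn)
      (aestronglyMeasurable_sq hw t _) ?_
    exact (ae_restrict_iff' hS).2
      (ae_of_all _ fun x hx => sq_le_of_decay (hdec 0 (by norm_num) t htI x hx))
  · exact (((continuous_pdx hw 0 t).mul (continuous_pdx hw 5 t)).const_mul 2).aestronglyMeasurable
  · refine (ae_restrict_iff' hS).2 (ae_of_all _ fun x hx s hs => ?_)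
    have hsI := Ioo_subset_Icc_self hs
    rw [Real.norm_eq_abs, abs_mul, abs_two]
    gcongr
    exact abs_mul_le_of_decay (hdec 0 (by norm_num) s hsI x hx) (hdec 5 le_rfl s hsI x hx)
  · exact ((integrable_inv_one_add_sq.const_mul (K ^ 2)).const_mul 2).integrableOn
  · refine (ae_restrict_iff' hS).2 (ae_of_all _ fun x hx s hs => ?_)
    refine ((hasDerivAt_pdt hw x s).pow 2).congr_deriv ?_
    rw [heq x hx s (Ioo_subset_Icc_self hs), pdx_zero]
    norm_num
    ring

end EdgeEnergy

lemma integral_Iic_flux_deriv {w : ℝ × ℝ → ℝ} (hw : ContDiff ℝ (⊤ : ℕ∞) w) {K t : ℝ}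
    (hdec : ∀ k ≤ 5, ∀ x ∈ Iic (0 : ℝ), |pdx k w x t| ≤ K * (1 + x ^ 2)⁻¹) :
    ∫ x in Iic (0 : ℝ), pdx 0 w x t * pdx 5 w x t = kawaharaFlux w 0 t := by
  have hlim : Tendsto (fun x => kawaharaFlux w x t) atBot (𝓝 0) :=
    squeeze_zero_norm' ((eventually_le_atBot 0).mono fun x hx =>
      abs_kawaharaFlux_le fun k hk => hdec k hk x hx)
      (tendsto_const_mul_inv_one_add_sq atBot_le_cocompact (3 * K ^ 2))
  rw [integral_Iic_of_hasDerivAt_of_tendsto' (fun x _ => hasDerivAt_kawaharaFlux hw x t)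
    (integrableOn_flux_deriv hw measurableSet_Iic hdec) hlim, sub_zero]

lemma integral_Ici_flux_deriv {w : ℝ × ℝ → ℝ} (hw : ContDiff ℝ (⊤ : ℕ∞) w) {K t : ℝ}
    (hdec : ∀ k ≤ 5, ∀ x ∈ Ici (0 : ℝ), |pdx k w x t| ≤ K * (1 + x ^ 2)⁻¹) :
    ∫ x in Ici (0 : ℝ), pdx 0 w x t * pdx 5 w x t = -kawaharaFlux w 0 t := by
  have hlim : Tendsto (fun x => kawaharaFlux w x t) atTop (𝓝 0) :=
    squeeze_zero_norm' ((eventually_ge_atTop 0).mono fun x hx =>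
      abs_kawaharaFlux_le fun k hk => hdec k hk x hx)
      (tendsto_const_mul_inv_one_add_sq atTop_le_cocompact (3 * K ^ 2))
  rw [integral_Ici_eq_integral_Ioi,
    integral_Ioi_of_hasDerivAt_of_tendsto' (fun x _ => hasDerivAt_kawaharaFlux hw x t)
    ((integrableOn_flux_deriv hw measurableSet_Ici hdec).mono_set Ioi_subset_Ici_self) hlim,
    zero_sub]

/-- The net flux through the vertex is nonpositive when the coupling matrix is a contraction. -/
lemma sum_kawaharaFlux_le {k m : ℕ} {hk : 0 < k} {T : ℝ} {a b : Fin (k + m) → ℝ}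
    (ha : ∀ i, a i ≠ 0) (hb : ∀ i, b i ≠ 0) {C : Matrix (Fin k) (Fin m) ℝ}
    (hC : ∀ x : Fin m → ℝ,
      ∑ i : Fin k, (∑ j : Fin m, C i j * x j) ^ 2 ≤ ∑ j : Fin m, (x j) ^ 2)
    {u : Fin k → ℝ × ℝ → ℝ} {v : Fin m → ℝ × ℝ → ℝ}
    (hvc : KawaharaVertexConditions k m hk T a b C u v) {t : ℝ} (ht : t ∈ Icc 0 T) :
    ∑ i, kawaharaFlux (u i) 0 t ≤ ∑ j, kawaharaFlux (v j) 0 t := by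
  obtain ⟨hu0, hv0, hu1, hv1, h2, h3, h4⟩ := hvc t ht
  have h04 : ∑ i, pdx 0 (u i) 0 t * pdx 4 (u i) 0 t
      = ∑ j, pdx 0 (v j) 0 t * pdx 4 (v j) 0 t := by
    have hu (i) : pdx 0 (u i) 0 t * pdx 4 (u i) 0 t
        = u ⟨0, hk⟩ (0, t) * ((a (Fin.castAdd m i))⁻¹ * pdx 4 (u i) 0 t) := by
      rw [hu0 i, pdx_zero]
      field_simp [ha (Fin.castAdd m i)]
    have hv (j) : pdx 0 (v j) 0 t * pdx 4 (v j) 0 t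
        = u ⟨0, hk⟩ (0, t) * ((a (Fin.natAdd k j))⁻¹ * pdx 4 (v j) 0 t) := by
      rw [hv0 j, pdx_zero]
      field_simp [ha (Fin.natAdd k j)]
    simp_rw [hu, hv, ← Finset.mul_sum, h4]
  have h13 : ∑ i, pdx 1 (u i) 0 t * pdx 3 (u i) 0 t
      = ∑ j, pdx 1 (v j) 0 t * pdx 3 (v j) 0 t := by
    have hu (i) : pdx 1 (u i) 0 t * pdx 3 (u i) 0 t
        = pdx 1 (u ⟨0, hk⟩) 0 t * ((b (Fin.castAdd m i))⁻¹ * pdx 3 (u i) 0 t) := by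
      rw [hu1 i]
      field_simp [hb (Fin.castAdd m i)]
    have hv (j) : pdx 1 (v j) 0 t * pdx 3 (v j) 0 t
        = pdx 1 (u ⟨0, hk⟩) 0 t * ((b (Fin.natAdd k j))⁻¹ * pdx 3 (v j) 0 t) := by
      rw [hv1 j]
      field_simp [hb (Fin.natAdd k j)]
    rw [Finset.sum_congr rfl fun i _ => hu i, Finset.sum_congr rfl fun j _ => hv j,
      ← Finset.mul_sum, ← Finset.mul_sum, h3]
  have h22 : ∑ i, pdx 2 (u i) 0 t ^ 2 ≤ ∑ j, pdx 2 (v j) 0 t ^ 2 := by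
    simpa only [h2] using hC fun j => pdx 2 (v j) 0 t
  simp only [kawaharaFlux, Finset.sum_add_distrib, Finset.sum_sub_distrib, ← Finset.sum_div]
  linarith

/-- Energy decay for the linearized Kawahara system on a star graph: if the
vertex coupling matrix `C` is a contraction, the total energy is nonincreasing
on `[0,T]`. -/
theorem kawahara_star_energy_nonincreasing
    (k m : ℕ) (hk : 0 < k) (hm : 0 < m) (T : ℝ) (hT : 0 < T)
    (a b : Fin (k + m) → ℝ) (ha : ∀ i, a i ≠ 0) (hb : ∀ i, b i ≠ 0)
    (C : Matrix (Fin k) (Fin m) ℝ)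
    (hC : ∀ x : Fin m → ℝ,
      ∑ i : Fin k, (∑ j : Fin m, C i j * x j) ^ 2 ≤ ∑ j : Fin m, (x j) ^ 2)
    (u : Fin k → ℝ × ℝ → ℝ) (v : Fin m → ℝ × ℝ → ℝ)
    (hu_smooth : ∀ i, ContDiff ℝ (⊤ : ℕ∞) (u i))
    (hv_smooth : ∀ j, ContDiff ℝ (⊤ : ℕ∞) (v j))
    (hu_eq : ∀ i, ∀ x ≤ (0:ℝ), ∀ t ∈ Icc (0:ℝ) T, pdt (u i) x t = pdx 5 (u i) x t)
    (hv_eq : ∀ j, ∀ x : ℝ, 0 ≤ x → ∀ t ∈ Icc (0:ℝ) T, pdt (v j) x t = pdx 5 (v j) x t)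
    (hu_dec : ∀ i, LeftDecay5 (u i) T)
    (hv_dec : ∀ j, RightDecay5 (v j) T)
    (hvc : KawaharaVertexConditions k m hk T a b C u v) :
    AntitoneOn (fun t =>
        (∑ i : Fin k, ∫ x in Iic (0:ℝ), (u i (x, t)) ^ 2)
          + ∑ j : Fin m, ∫ x in Ici (0:ℝ), (v j (x, t)) ^ 2)
      (Icc (0:ℝ) T) := by
  choose Ku _ hu using hu_dec
  choose Kv _ hv using hv_dec
  have hderiv : ∀ t ∈ Ioo 0 T, HasDerivAt (fun t =>
      (∑ i : Fin k, ∫ x in Iic (0:ℝ), (u i (x, t)) ^ 2)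
        + ∑ j : Fin m, ∫ x in Ici (0:ℝ), (v j (x, t)) ^ 2)
      ((∑ i, 2 * kawaharaFlux (u i) 0 t) + ∑ j, 2 * -kawaharaFlux (v j) 0 t) t := by
    intro t ht
    have htI := Ioo_subset_Icc_self ht
    refine (HasDerivAt.fun_sum fun i _ => ?_).add (HasDerivAt.fun_sum fun j _ => ?_)
    · rw [← integral_Iic_flux_deriv (hu_smooth i) fun l hl x hx => hu i l hl t htI x hx]
      exact hasDerivAt_energy (hu_smooth i) measurableSet_Iic (hu_eq i) (hu i) ht
    · rw [← integral_Ici_flux_deriv (hv_smooth j) fun l hl x hx => hv j l hl t htI x hx]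
      exact hasDerivAt_energy (hv_smooth j) measurableSet_Ici (hv_eq j) (hv j) ht
  refine antitoneOn_of_deriv_nonpos (convex_Icc 0 T) ?_ ?_ ?_
  · exact (continuousOn_finsetSum _ fun i _ =>
      continuousOn_energy (hu_smooth i) measurableSet_Iic (hu i)).add
      (continuousOn_finsetSum _ fun j _ =>
        continuousOn_energy (hv_smooth j) measurableSet_Ici (hv j))
  · rw [interior_Icc]
    exact fun t ht => (hderiv t ht).differentiableAt.differentiableWithinAt
  · rw [interior_Icc]
    intro t ht
    rw [(hderiv t ht).deriv]
    have hflux := sum_kawaharaFlux_le ha hb hC hvc (Ioo_subset_Icc_self ht)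
    simp only [mul_neg, Finset.sum_neg_distrib, ← Finset.mul_sum]
    linarith
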